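/- Let n be a nonnegative integer and a, b, c, d, e, f, g, p, q ∈ ℂ satisfying 3a = b+c+d+e+f+g−n. Set λ = 2a−b−c−d and μ = 2a−e−f−g. Let γ, δ, ε ∈ ℂ satisfy γ² = λ²/4 − p(a−p)(a−b−c)(a−b−d)(a−c−d)/(bcd + p(a−p)(a−b−c−d)), δ² = μ²/4 − q(a−q)(a−e−f)(a−e−g)(a−f−g)/(efg + q(a−q)(a−e−f−g)), and ε² = λ²/4 − [q(a−q)(a−e−f)(a−e−g)(a−f−g) + n(μ+n)(efg + q(a−q)(a−e−f−g))] / [(a−e−f)(a−e−g)(a−f−g) − (μ+n)(ef+eg+fg+a(a−e−f−g)−q(a−q))], where all three defining fractions have nonzero denominators. Assume the parameters are nondegenerate for the identity below. Then ₁₃F₁₂(a, 1+a/2, b, c, d, e, f, g, a−p+1, p+1, a−q+1, q+1, −n; a/2, 1+a−b, 1+a−c, 1+a−d, 1+a−e, 1+a−f, 1+a−g, p, a−p, q, a−q, 1+a+n; 1) = [ (1+a)_n (1+λ−e)_n (1+λ−f)_n (1+λ−g)_n / ( (1+λ)_n (1+a−e)_n (1+a−f)_n (1+a−g)_n ) ]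 · [ (μ/2−δ+1)_n (μ/2+δ+1)_n / ( (μ/2+δ)_n (μ/2−δ)_n ) ] · ₁₃F₁₂(λ, 1+λ/2, λ+b−a, λ+c−a, λ+d−a, e, f, g, λ/2−γ+1, λ/2+γ+1, λ/2−ε+1, λ/2+ε+1, −n; λ/2, 1+a−b, 1+a−c, 1+a−d, 1+λ−e, 1+λ−f, 1+λ−g, λ/2+γ, λ/2−γ, λ/2+ε, λ/2−ε, 1+λ+n; 1). -/

import Mathlib

/-- Rising factorial (Pochhammer symbol) `(a)ₖ = a(a+1)⋯(a+k−1)`. -/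
noncomputable def poch (a : ℂ) (k : ℕ) : ℂ := (ascPochhammer ℂ k).eval a

/-- Terminating hypergeometric sum with numerator parameters `A` together with
the extra top parameter `-n`, denominator parameters `B`, and argument `x`. -/
noncomputable def hypTerm (A B : List ℂ) (n : ℕ) (x : ℂ) : ℂ :=
  ∑ k ∈ Finset.range (n + 1),
    ((A.map fun a => poch a k).prod * poch (-(n : ℂ)) k) /
      ((k.factorial : ℂ) * (B.map fun b => poch b k).prod) * x ^ k

lemma poch_zero (a : ℂ) : poch a 0 = 1 := by simp [poch]

lemma poch_succ (a : ℂ) (k : ℕ) : poch a (k + 1) = poch a k * (a + k) := by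
  simp [poch, ascPochhammer_succ_eval]

lemma poch_add (a : ℂ) (m k : ℕ) : poch a (m + k) = poch a m * poch (a + m) k := by
  induction k with
  | zero => simp [poch_zero]
  | succ k ih => rw [← add_assoc, poch_succ, ih, poch_succ]; push_cast; ring

lemma poch_succ_left (a : ℂ) (k : ℕ) : poch a (k + 1) = a * poch (a + 1) k := by
  rw [add_comm k 1, poch_add, poch_succ, poch_zero]; simp

lemma poch_ne_zero_iff {a : ℂ} {k : ℕ} : poch a k ≠ 0 ↔ ∀ i < k, a + i ≠ 0 := by
  induction k with
  | zero => simp [poch_zero]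
  | succ k ih =>
    rw [poch_succ, mul_ne_zero_iff, ih]
    constructor
    · rintro ⟨h1, h2⟩ i hi
      rcases Nat.lt_succ_iff_lt_or_eq.mp hi with h | rfl
      exacts [h1 i h, h2]
    · exact fun h => ⟨fun i hi => h i (by omega), h k (by omega)⟩

lemma poch_ne_zero_of_le {a : ℂ} {j k : ℕ} (hjk : j ≤ k) (h : poch a k ≠ 0) : poch a j ≠ 0 :=
  poch_ne_zero_iff.2 fun i hi => poch_ne_zero_iff.1 h i (by omega)

lemma poch_reflect (z : ℂ) (m : ℕ) : poch (1 - z - m) m = (-1) ^ m * poch z m := by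
  induction m generalizing z with
  | zero => simp [poch_zero]
  | succ m ih =>
    have h : 1 - z - ((m + 1 : ℕ) : ℂ) + 1 = 1 - z - m := by push_cast; ring
    rw [poch_succ_left, h, ih, poch_succ]; push_cast; ring

lemma poch_neg_natCast {n k : ℕ} (h : k ≤ n) :
    poch (-(n : ℂ)) k = (-1) ^ k * (n.factorial / (n - k).factorial) := by
  induction k with
  | zero => simp [poch_zero, Nat.factorial_ne_zero]
  | succ k ih =>
    obtain ⟨m, rfl⟩ : ∃ m, n = k + 1 + m := ⟨n - (k + 1), by omega⟩
    have h1 : k + 1 + m - k = m + 1 := by omega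
    have h2 : k + 1 + m - (k + 1) = m := by omega
    rw [poch_succ, ih (by omega), h1, h2]
    have : (m.factorial : ℂ) ≠ 0 := by exact_mod_cast m.factorial_ne_zero
    have : (m : ℂ) + 1 ≠ 0 := by exact_mod_cast m.succ_ne_zero
    rw [Nat.factorial_succ m]
    push_cast
    field_simp
    ring

lemma continuous_poch (k : ℕ) : Continuous fun a => poch a k := by
  unfold poch; fun_prop

/-- The very-well-poised factor in three parameters `B`, `C`, `D` with base `s`. -/
noncomputable def vwp (s B C D : ℂ) (j : ℕ) : ℂ :=
  (s + 2 * j) / s * poch s j * poch B j * poch C j * poch D j /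
    (j.factorial * poch (1 + s - B) j * poch (1 + s - C) j * poch (1 + s - D) j)

/-- The kernel of Bailey's change of base from `a` to `s`. -/
noncomputable def baileyKer (a s : ℂ) (k j : ℕ) : ℂ :=
  poch a (k + j) * poch (a - s) (k - j) / ((k - j).factorial * poch (1 + s) (k + j))

lemma dougall_step_aux {s X1 X2 X3 X4 X5 X6 X7 X8 X9 X10 Y1 Y2 u1 u2 u3 u4 u5 j1 m1 v1 v2 v3 v4 v5
    v6 v7 v8 v9 v10 v11 v12 v13 v14 v15 v16 v17 v18 v19 v20 v21 : ℂ}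
    (hu5 : u5 ≠ 0) (hu1 : u1 ≠ 0) (hu2 : u2 ≠ 0) (hu3 : u3 ≠ 0) (hm1 : m1 ≠ 0) (hj1 : j1 ≠ 0)
    (key : -v1 * v11 * j1 * u1 * u2 * u3 * u5 +
      v13 * (v14 * v15 * v16 * v17 * v12 * v11 - v18 * v19 * v20 * v21 * m1 * u5) =
      -v1 * v9 * v5 * v6 * v7 * v12 * m1) :
    -v1 * (X10 * v8 * (X7 * v2) * (X8 * v3) * (X9 * v4) / (s * Y2 * X4 * X5 * X6)) *
        (X2 * v10 * (X3 * v11) / (m1 * Y1 * (X1 * u4))) +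
      v13 / s * (X10 * v8) * (X7 * v2) * (X8 * v3) * (X9 * v4) /
          (j1 * Y2 * (X4 * u1) * (X5 * u2) * (X6 * u3)) *
        (v14 * v15 * v16 * v17 * (X2 * v10 * v12 * (X3 * v11) / (m1 * Y1 * (X1 * u4 * u5))) -
          v18 * v19 * v20 * v21 * (X2 * v10 * X3 / (Y1 * (X1 * u4)))) =
    -v1 * (X10 * v8 * v9 * (X7 * v2 * v5) * (X8 * v3 * v6) * (X9 * v4 * v7) /
          (s * (j1 * Y2) * (X4 * u1) * (X5 * u2) * (X6 * u3))) *
      (X2 * v10 * v12 * X3 / (Y1 * (X1 * u4 * u5))) := by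
  have key' : -v1 * (v11 / m1) + v13 / (j1 * u1 * u2 * u3) *
      (v14 * v15 * v16 * v17 * v12 * v11 / (m1 * u5) - v18 * v19 * v20 * v21) =
      -v1 * v9 * v5 * v6 * v7 * v12 / (j1 * u1 * u2 * u3 * u5) := by
    field_simp
    linear_combination key
  linear_combination (X10 * v8 * X7 * v2 * X8 * v3 * X9 * v4 * X2 * v10 * X3 /
    (s * Y2 * X4 * X5 * X6 * Y1 * X1 * u4)) * key'

lemma sum_dougall_telescope {s B C D a : ℂ} (k J : ℕ) (hJ : J ≤ k) (hs : s ≠ 0)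
    (ha : a = 1 + 2 * s - B - C - D) (h1 : poch (1 + s) (2 * (k + 1)) ≠ 0)
    (hB : poch (1 + s - B) (k + 1) ≠ 0) (hC : poch (1 + s - C) (k + 1) ≠ 0)
    (hD : poch (1 + s - D) (k + 1) ≠ 0) :
    ∑ j ∈ Finset.range (J + 1), vwp s B C D j *
        ((k + 1) * (1 + s - B + k) * (1 + s - C + k) * (1 + s - D + k) * baileyKer a s (k + 1) j -
          (a + k) * (1 + s - C - D + k) * (1 + s - B - D + k) * (1 + s - B - C + k) *
            baileyKer a s k j) =
      -(a + 2 * k + 1) *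
        (poch s (J + 1) * poch B (J + 1) * poch C (J + 1) * poch D (J + 1) /
          (s * J.factorial * poch (1 + s - B) J * poch (1 + s - C) J * poch (1 + s - D) J)) *
        (poch a (k + J + 1) * poch (a - s) (k - J) /
          ((k - J).factorial * poch (1 + s) (k + J + 1))) := by
  subst ha
  induction J with
  | zero =>
    have e1 := poch_ne_zero_of_le (show k + 1 ≤ 2 * (k + 1) by omega) h1
    rw [poch_succ, mul_ne_zero_iff] at e1
    have := e1.1
    have := e1.2
    have : (k.factorial : ℂ) ≠ 0 := by exact_mod_cast k.factorial_ne_zero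
    have : (k : ℂ) + 1 ≠ 0 := by exact_mod_cast k.succ_ne_zero
    simp only [zero_add, Finset.sum_range_one, vwp, baileyKer, poch_succ, poch_zero, add_zero,
      Nat.sub_zero, Nat.factorial_succ, Nat.factorial_zero]
    push_cast
    field_simp
    ring
  | succ J ih =>
    obtain ⟨m, rfl⟩ : ∃ m, k = J + 1 + m := ⟨k - (J + 1), by omega⟩
    rw [Finset.sum_range_succ, ih (by omega)]
    clear ih
    have e1 := poch_ne_zero_of_le (show J + 1 + m + J + 1 + 1 ≤ 2 * (J + 1 + m + 1) by omega) h1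
    have eB := poch_ne_zero_of_le (show J + 1 ≤ J + 1 + m + 1 by omega) hB
    have eC := poch_ne_zero_of_le (show J + 1 ≤ J + 1 + m + 1 by omega) hC
    have eD := poch_ne_zero_of_le (show J + 1 ≤ J + 1 + m + 1 by omega) hD
    clear h1 hB hC hD
    rw [poch_succ, mul_ne_zero_iff] at eB eC eD
    rw [poch_succ, poch_succ, mul_ne_zero_iff, mul_ne_zero_iff] at e1
    obtain ⟨⟨e1, e2⟩, e3⟩ := e1
    obtain ⟨eB, eB'⟩ := eB
    obtain ⟨eC, eC'⟩ := eC
    obtain ⟨eD, eD'⟩ := eD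
    have d1 : J + 1 + m - J = m + 1 := by omega
    have d2 : J + 1 + m - (J + 1) = m := by omega
    have d3 : J + 1 + m + 1 - (J + 1) = m + 1 := by omega
    have d4 : J + 1 + m + (J + 1) = J + 1 + m + J + 1 := by omega
    have d5 : J + 1 + m + 1 + (J + 1) = J + 1 + m + J + 1 + 1 := by omega
    have : (m.factorial : ℂ) ≠ 0 := by exact_mod_cast m.factorial_ne_zero
    have : (m : ℂ) + 1 ≠ 0 := by exact_mod_cast m.succ_ne_zero
    have : (J.factorial : ℂ) ≠ 0 := by exact_mod_cast J.factorial_ne_zero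
    have : (J : ℂ) + 1 ≠ 0 := by exact_mod_cast J.succ_ne_zero
    simp only [vwp, baileyKer, d1, d2, d3, d4, d5, Nat.factorial_succ, poch_succ]
    push_cast at *
    refine dougall_step_aux e3 eB' eC' eD' ‹_› ‹_› ?_
    ring

lemma dougall_top_aux {s X1 X2 X3 X4 X5 X6 X7 X8 X9 X10 Z1 Z2 Z3 Y1 u1 u2 u3 u4 u5 j1 v1 v2 v3 v4
    v8 v10 v12 v13 v18 v19 v20 v21 : ℂ} (hs : s ≠ 0)
    (hX2 : X2 ≠ 0) (hu4 : u4 ≠ 0) (hu5 : u5 ≠ 0) (hX4 : X4 ≠ 0) (hu1 : u1 ≠ 0)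
    (hX5 : X5 ≠ 0) (hu2 : u2 ≠ 0) (hX6 : X6 ≠ 0) (hu3 : u3 ≠ 0)
    (hY1 : Y1 ≠ 0) (hj1 : j1 ≠ 0) (key : v13 * v12 = v1 * u5) :
    -v1 * (X10 * v8 * (X7 * v2) * (X8 * v3) * (X9 * v4) / (s * Y1 * X4 * X5 * X6)) *
          (X1 * v10 * 1 / (1 * (X2 * u4))) +
        v18 * v19 * v20 * v21 * (X3 * Z1 * Z2 * Z3 / (Y1 * X4 * X5 * X6)) +
      j1 * u1 * u2 * u3 *
        (v13 / s * (X10 * v8) * (X7 * v2) * (X8 * v3) * (X9 * v4) /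
            (j1 * Y1 * (X4 * u1) * (X5 * u2) * (X6 * u3)) *
          (X1 * v10 * v12 * 1 / (1 * (X2 * u4 * u5)))) =
    j1 * u1 * u2 * u3 *
      (X3 * v18 * (Z1 * v19) * (Z2 * v20) * (Z3 * v21) /
        (j1 * Y1 * (X4 * u1) * (X5 * u2) * (X6 * u3))) := by
  field_simp
  linear_combination (X10 * v8 * X7 * v2 * X8 * v3 * X9 * v4 * X1 * v10) * key

/-- Dougall's theorem, in Bailey-pair form. -/
lemma sum_vwp_baileyKer {s B C D a : ℂ} (k : ℕ) (hs : s ≠ 0)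
    (ha : a = 1 + 2 * s - B - C - D) (h1 : poch (1 + s) (2 * k) ≠ 0)
    (hB : poch (1 + s - B) k ≠ 0) (hC : poch (1 + s - C) k ≠ 0) (hD : poch (1 + s - D) k ≠ 0) :
    ∑ j ∈ Finset.range (k + 1), vwp s B C D j * baileyKer a s k j =
      poch a k * poch (1 + s - C - D) k * poch (1 + s - B - D) k * poch (1 + s - B - C) k /
        (k.factorial * poch (1 + s - B) k * poch (1 + s - C) k * poch (1 + s - D) k) := by
  induction k with
  | zero => simp [vwp, baileyKer, poch_zero, hs]
  | succ k ih =>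
    have ih := ih (poch_ne_zero_of_le (by omega) h1) (poch_ne_zero_of_le (by omega) hB)
      (poch_ne_zero_of_le (by omega) hC) (poch_ne_zero_of_le (by omega) hD)
    have tel := sum_dougall_telescope k k le_rfl hs ha h1 hB hC hD
    simp only [mul_sub, Finset.sum_sub_distrib] at tel
    have r1 : ∀ u : ℂ, ∀ g : ℕ → ℂ, ∑ j ∈ Finset.range (k + 1), vwp s B C D j * (u * g j) =
        u * ∑ j ∈ Finset.range (k + 1), vwp s B C D j * g j := by
      intro u g; rw [Finset.mul_sum]; exact Finset.sum_congr rfl fun _ _ => by ring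
    rw [r1, r1, ih] at tel
    rw [Finset.sum_range_succ]
    generalize ∑ j ∈ Finset.range (k + 1), vwp s B C D j * baileyKer a s (k + 1) j = S at *
    have d1 : 2 * (k + 1) = k + k + 1 + 1 := by omega
    have d2 : k + 1 + (k + 1) = k + k + 1 + 1 := by omega
    rw [d1, poch_succ, poch_succ, mul_ne_zero_iff, mul_ne_zero_iff] at h1
    rw [poch_succ, mul_ne_zero_iff] at hB hC hD
    obtain ⟨⟨e1, e2⟩, e3⟩ := h1
    obtain ⟨eB, eB'⟩ := hB
    obtain ⟨eC, eC'⟩ := hC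
    obtain ⟨eD, eD'⟩ := hD
    have : (k.factorial : ℂ) ≠ 0 := by exact_mod_cast k.factorial_ne_zero
    have hk : (k : ℂ) + 1 ≠ 0 := by exact_mod_cast k.succ_ne_zero
    have hc : ((k : ℂ) + 1) * (1 + s - B + k) * (1 + s - C + k) * (1 + s - D + k) ≠ 0 := by
      simp [hk, eB', eC', eD']
    apply mul_left_cancel₀ hc
    rw [mul_add, eq_add_of_sub_eq tel]
    clear tel hc
    simp only [vwp, baileyKer, d2, Nat.factorial_succ, poch_succ, Nat.sub_self, Nat.factorial_zero,
      poch_zero]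
    push_cast at *
    refine dougall_top_aux hs e1 e2 e3 eB eB' eC eC' eD eD' ‹_› ‹_› ?_
    subst ha
    ring

lemma vwp_succ {s B C D : ℂ} (j : ℕ) (hs : s ≠ 0) (hs2 : s + 2 ≠ 0)
    (hB : poch (1 + s - B) (j + 1) ≠ 0) (hC : poch (1 + s - C) (j + 1) ≠ 0)
    (hD : poch (1 + s - D) (j + 1) ≠ 0) :
    vwp s B C D (j + 1) * ((j + 1) * (s + (j + 1))) =
      (s + 1) * (s + 2) * (B * C * D) / ((1 + s - B) * (1 + s - C) * (1 + s - D)) *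
        vwp (s + 2) (B + 1) (C + 1) (D + 1) j := by
  have hj : (j : ℂ) + 1 ≠ 0 := by exact_mod_cast j.succ_ne_zero
  have hf : (j.factorial : ℂ) ≠ 0 := by exact_mod_cast j.factorial_ne_zero
  have hp : poch s (j + 1) * (s + (j + 1)) = s * (s + 1) * poch (s + 2) j := by
    have := poch_succ s (j + 1)
    push_cast at this
    rw [← this, poch_succ_left, poch_succ_left]
    ring_nf
  have hX : ∀ X : ℂ, 1 + (s + 2) - (X + 1) = 1 + s - X + 1 := fun X => by ring
  rw [poch_succ_left] at hB hC hD
  simp only [vwp, hX, poch_succ_left B, poch_succ_left C, poch_succ_left D,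
    poch_succ_left (1 + s - B), poch_succ_left (1 + s - C), poch_succ_left (1 + s - D),
    Nat.factorial_succ]
  push_cast
  simp only [mul_ne_zero_iff] at hB hC hD
  obtain ⟨eB, eB'⟩ := hB
  obtain ⟨eC, eC'⟩ := hC
  obtain ⟨eD, eD'⟩ := hD
  generalize 1 + s - B = u1 at *
  generalize 1 + s - C = u2 at *
  generalize 1 + s - D = u3 at *
  field_simp
  linear_combination (B * poch (B + 1) j * (C * poch (C + 1) j) * (D * poch (D + 1) j) *
    (s + 2 * (j + 1))) * hp

lemma baileyKer_succ_succ {a s : ℂ} (k j : ℕ) (hs1 : s + 1 ≠ 0) (hs2 : s + 2 ≠ 0) :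
    (s + 1) * (s + 2) * baileyKer a s (k + 1) (j + 1) =
      a * (a + 1) * baileyKer (a + 2) (s + 2) k j := by
  have h1 : k + 1 + (j + 1) = k + j + 1 + 1 := by ring
  have h2 : k + 1 - (j + 1) = k - j := by omega
  have h3 : a + 1 + 1 = a + 2 := by ring
  have h4 : 1 + s + 1 + 1 = 1 + (s + 2) := by ring
  have h5 : a + 2 - (s + 2) = a - s := by ring
  have h6 : 1 + s ≠ 0 := by rwa [add_comm]
  have h7 : 1 + s + 1 ≠ 0 := by convert hs2 using 1; ring
  simp only [baileyKer, h1, h2, poch_succ_left _ (k + j + 1), poch_succ_left _ (k + j), h3, h4, h5]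
  field_simp
  ring

/-- The factor shared by the two terms of the sums of balance two. -/
noncomputable def bailRHS (s B C D : ℂ) (k : ℕ) : ℂ :=
  poch (1 + s - C - D) k * poch (1 + s - B - D) k * poch (1 + s - B - C) k /
    ((k + 1).factorial * poch (1 + s - B) (k + 1) * poch (1 + s - C) (k + 1) *
      poch (1 + s - D) (k + 1))

lemma sum_index_mul_vwp {s B C D a : ℂ} (k : ℕ) (hs : s ≠ 0)
    (ha : a = 2 * s - B - C - D) (h1 : poch (1 + s) (2 * (k + 1)) ≠ 0)
    (hB : poch (1 + s - B) (k + 1) ≠ 0) (hC : poch (1 + s - C) (k + 1) ≠ 0)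
    (hD : poch (1 + s - D) (k + 1) ≠ 0) :
    ∑ j ∈ Finset.range (k + 1 + 1), vwp s B C D j * (j * (s + j)) * baileyKer a s (k + 1) j =
      poch a (k + 1) * bailRHS s B C D k * ((k + 1) * (a + (k + 1)) * (B * C * D)) := by
  have hd : 2 * (k + 1) = 2 * k + 1 + 1 := by ring
  have h1' := h1
  rw [hd, poch_succ_left, poch_succ_left] at h1'
  simp only [mul_ne_zero_iff] at h1'
  obtain ⟨hs1, hs2, h1'⟩ := h1'
  rw [add_comm] at hs1
  have hs2' : s + 2 ≠ 0 := by convert hs2 using 1; ring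
  have hX : ∀ X : ℂ, 1 + (s + 2) - (X + 1) = 1 + s - X + 1 := fun X => by ring
  have hY : ∀ X Y : ℂ, 1 + s - X + 1 - (Y + 1) = 1 + s - X - Y := fun X Y => by ring
  have e : 1 + s + 1 + 1 = 1 + (s + 2) := by ring
  rw [Finset.sum_range_succ']
  simp only [Nat.cast_zero, zero_mul, mul_zero, add_zero]
  have hterm : ∀ j ∈ Finset.range (k + 1),
      vwp s B C D (j + 1) * (((j + 1 : ℕ) : ℂ) * (s + ((j + 1 : ℕ) : ℂ))) *
        baileyKer a s (k + 1) (j + 1) =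
      (B * C * D) / ((1 + s - B) * (1 + s - C) * (1 + s - D)) * (a * (a + 1)) *
        (vwp (s + 2) (B + 1) (C + 1) (D + 1) j * baileyKer (a + 2) (s + 2) k j) := by
    intro j hj
    have hj' : j + 1 ≤ k + 1 := by simpa using hj
    push_cast
    rw [vwp_succ j hs hs2' (poch_ne_zero_of_le hj' hB) (poch_ne_zero_of_le hj' hC)
      (poch_ne_zero_of_le hj' hD)]
    linear_combination ((B * C * D) / ((1 + s - B) * (1 + s - C) * (1 + s - D)) *
      vwp (s + 2) (B + 1) (C + 1) (D + 1) j) * baileyKer_succ_succ (a := a) k j hs1 hs2'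
  rw [Finset.sum_congr rfl hterm, ← Finset.mul_sum]
  have pB := hB
  have pC := hC
  have pD := hD
  rw [poch_succ_left, mul_ne_zero_iff] at pB pC pD
  rw [sum_vwp_baileyKer k hs2' (by rw [ha]; ring) (by rw [← e]; exact h1')
    (by rw [hX]; exact pB.2) (by rw [hX]; exact pC.2) (by rw [hX]; exact pD.2)]
  have hp : a * (a + 1) * poch (a + 2) k = poch a (k + 1) * (a + (k + 1)) := by
    have := poch_succ a (k + 1)
    push_cast at this
    rw [← this, poch_succ_left, poch_succ_left]
    ring_nf
  have hk : (k : ℂ) + 1 ≠ 0 := by exact_mod_cast k.succ_ne_zero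
  have hf : (k.factorial : ℂ) ≠ 0 := by exact_mod_cast k.factorial_ne_zero
  simp only [bailRHS, hX, hY, poch_succ_left (1 + s - B), poch_succ_left (1 + s - C),
    poch_succ_left (1 + s - D), Nat.factorial_succ]
  push_cast
  obtain ⟨eB, eB'⟩ := pB
  obtain ⟨eC, eC'⟩ := pC
  obtain ⟨eD, eD'⟩ := pD
  generalize poch (1 + s - C - D) k = Z1
  generalize poch (1 + s - B - D) k = Z2
  generalize poch (1 + s - B - C) k = Z3
  generalize 1 + s - B = u1 at *
  generalize 1 + s - C = u2 at *
  generalize 1 + s - D = u3 at *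
  field_simp
  linear_combination (B * C * D * Z1 * Z2 * Z3) * hp

lemma sum_complement_mul_vwp {s B C D a : ℂ} (k : ℕ) (hs : s ≠ 0)
    (ha : a = 2 * s - B - C - D) (h1 : poch (1 + s) (2 * (k + 1)) ≠ 0)
    (hB : poch (1 + s - B) (k + 1) ≠ 0) (hC : poch (1 + s - C) (k + 1) ≠ 0)
    (hD : poch (1 + s - D) (k + 1) ≠ 0) :
    ∑ j ∈ Finset.range (k + 1 + 1),
        vwp s B C D j * ((k + 1 - j) * (s + (k + 1) + j)) * baileyKer a s (k + 1) j =
      poch a (k + 1) * bailRHS s B C D k *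
        ((k + 1) * (a - s) * ((1 + s - B + k) * (1 + s - C + k) * (1 + s - D + k))) := by
  have hterm : ∀ j ∈ Finset.range (k + 1),
      vwp s B C D j * ((k + 1 - j) * (s + (k + 1) + j)) * baileyKer a s (k + 1) j =
      a * (a - s) * (vwp s B C D j * baileyKer (a + 1) s k j) := by
    intro j hj
    have hj' : j ≤ k := by simpa [Nat.lt_succ_iff] using hj
    obtain ⟨m, rfl⟩ : ∃ m, k = j + m := ⟨k - j, by omega⟩
    have d1 : j + m + 1 - j = m + 1 := by omega
    have d2 : j + m - j = m := by omega
    have d3 : j + m + 1 + j = j + m + j + 1 := by omega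
    have e := poch_ne_zero_of_le (show j + m + j + 1 ≤ 2 * (j + m + 1) by omega) h1
    have hm : (m : ℂ) + 1 ≠ 0 := by exact_mod_cast m.succ_ne_zero
    have hf : (m.factorial : ℂ) ≠ 0 := by exact_mod_cast m.factorial_ne_zero
    rw [poch_succ, mul_ne_zero_iff] at e
    obtain ⟨e1, e2⟩ := e
    have h3 : a - s + 1 = a + 1 - s := by ring
    simp only [baileyKer, d1, d2, d3, poch_succ_left a, poch_succ_left (a - s),
      poch_succ (1 + s), Nat.factorial_succ, h3]
    push_cast at *
    have e3 : s + (j + m + 1) + j = 1 + s + (j + m + j) := by ring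
    rw [e3]
    generalize 1 + s + ((j : ℂ) + m + j) = u at *
    field_simp
    ring
  rw [Finset.sum_range_succ, Finset.sum_congr rfl hterm, ← Finset.mul_sum]
  have h0 : ((k : ℂ) + 1 - ((k + 1 : ℕ) : ℂ)) = 0 := by push_cast; ring
  rw [h0, sum_vwp_baileyKer k hs (by rw [ha]; ring) (poch_ne_zero_of_le (by omega) h1)
    (poch_ne_zero_of_le (by omega) hB) (poch_ne_zero_of_le (by omega) hC)
    (poch_ne_zero_of_le (by omega) hD)]
  rw [poch_succ, mul_ne_zero_iff] at hB hC hD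
  have hk : (k : ℂ) + 1 ≠ 0 := by exact_mod_cast k.succ_ne_zero
  have hf : (k.factorial : ℂ) ≠ 0 := by exact_mod_cast k.factorial_ne_zero
  simp only [bailRHS, poch_succ (1 + s - B), poch_succ (1 + s - C),
    poch_succ (1 + s - D), poch_succ_left a, Nat.factorial_succ]
  push_cast
  obtain ⟨eB, eB'⟩ := hB
  obtain ⟨eC, eC'⟩ := hC
  obtain ⟨eD, eD'⟩ := hD
  generalize poch (1 + s - C - D) k = Z1
  generalize poch (1 + s - B - D) k = Z2
  generalize poch (1 + s - B - C) k = Z3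
  generalize 1 + s - B + k = u1 at *
  generalize 1 + s - C + k = u2 at *
  generalize 1 + s - D + k = u3 at *
  field_simp
  ring

/-- The quadratic factor produced by the sums of balance two. -/
noncomputable def bailQuad (s B C D a x w0 w1 : ℂ) : ℂ :=
  w0 * ((s - C - D) * (s - B - D) * (s - B - C) + x * (a - s)) + w1 * (x * (B * C * D))

lemma sum_vwp_baileyKer_balance_two {s B C D a : ℂ} (w0 w1 : ℂ) (k : ℕ) (hs : s ≠ 0)
    (ha : a = 2 * s - B - C - D) (h1 : poch (1 + s) (2 * (k + 1)) ≠ 0)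
    (hB : poch (1 + s - B) (k + 1) ≠ 0) (hC : poch (1 + s - C) (k + 1) ≠ 0)
    (hD : poch (1 + s - D) (k + 1) ≠ 0) :
    ∑ j ∈ Finset.range (k + 1 + 1),
        vwp s B C D j * (w0 + w1 * (j * (s + j))) * baileyKer a s (k + 1) j =
      poch a (k + 1) * bailRHS s B C D k *
        bailQuad s B C D a ((k + 1) * (a + (k + 1))) w0 w1 := by
  have t1 := sum_index_mul_vwp k hs ha h1 hB hC hD
  have t0 := sum_complement_mul_vwp k hs ha h1 hB hC hD
  have hk : (k : ℂ) + 1 ≠ 0 := by exact_mod_cast k.succ_ne_zero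
  have hsk : s + (k + 1) ≠ 0 := by
    have := poch_ne_zero_iff.1 h1 k (by omega)
    convert this using 1
    ring
  have hc : ((k : ℂ) + 1) * (s + (k + 1)) ≠ 0 := mul_ne_zero hk hsk
  apply mul_left_cancel₀ hc
  have hsplit : ((k : ℂ) + 1) * (s + (k + 1)) * ∑ j ∈ Finset.range (k + 1 + 1),
        vwp s B C D j * (w0 + w1 * (j * (s + j))) * baileyKer a s (k + 1) j =
      w0 * ∑ j ∈ Finset.range (k + 1 + 1),
        vwp s B C D j * ((k + 1 - j) * (s + (k + 1) + j)) * baileyKer a s (k + 1) j +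
      (w0 + ((k : ℂ) + 1) * (s + (k + 1)) * w1) * ∑ j ∈ Finset.range (k + 1 + 1),
        vwp s B C D j * (j * (s + j)) * baileyKer a s (k + 1) j := by
    rw [Finset.mul_sum, Finset.mul_sum, Finset.mul_sum, ← Finset.sum_add_distrib]
    exact Finset.sum_congr rfl fun _ _ => by ring
  rw [hsplit, t0, t1, bailQuad]
  subst ha
  ring

open Filter Topology in
lemma eventually_poch_ne_zero (u : ℂ) {c : ℂ} (hc : c ≠ 0) (m : ℕ) :
    ∀ᶠ t in 𝓝[≠] (0 : ℂ), poch (u + c * t) m ≠ 0 := by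
  simp only [poch_ne_zero_iff]
  have h : ∀ i ∈ Finset.range m, ∀ᶠ t in 𝓝[≠] (0 : ℂ), u + c * t + i ≠ 0 := by
    intro i _
    have h2 : ∀ᶠ t in 𝓝[≠] (0 : ℂ), t ≠ -(u + i) / c := by
      by_cases h0 : -(u + i) / c = 0
      · rw [h0]; exact eventually_mem_nhdsWithin
      · exact (eventually_ne_nhds (Ne.symm h0)).filter_mono nhdsWithin_le_nhds
    filter_upwards [h2] with t ht h3
    apply ht
    field_simp
    linear_combination h3
  filter_upwards [(Filter.eventually_all_finset _).2 h] with t ht i hi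
  exact ht i (Finset.mem_range.2 hi)

/-- The kernel `baileyKer` with the factor `poch a k / poch (1 + s) k` removed. -/
noncomputable def baileyKerRed (a s : ℂ) (k j : ℕ) : ℂ :=
  poch (a + k) j * poch (a - s) (k - j) / ((k - j).factorial * poch (1 + s + k) j)

lemma baileyKer_eq (a s : ℂ) (k j : ℕ) :
    baileyKer a s k j = poch a k / poch (1 + s) k * baileyKerRed a s k j := by
  rw [baileyKer, baileyKerRed, poch_add, poch_add, div_mul_div_comm]
  ring_nf

open Filter Topology in
lemma sum_vwp_baileyKerRed {s B C D a : ℂ} (w0 w1 : ℂ) (k : ℕ) (hs : s ≠ 0)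
    (ha : a = 2 * s - B - C - D) (h1 : poch (1 + s + (k + 1 : ℕ)) (k + 1) ≠ 0)
    (hB : poch (1 + s - B) (k + 1) ≠ 0) (hC : poch (1 + s - C) (k + 1) ≠ 0)
    (hD : poch (1 + s - D) (k + 1) ≠ 0) :
    ∑ j ∈ Finset.range (k + 1 + 1),
        vwp s B C D j * (w0 + w1 * (j * (s + j))) * baileyKerRed a s (k + 1) j =
      poch (1 + s) (k + 1) * bailRHS s B C D k *
        bailQuad s B C D a ((k + 1) * (a + (k + 1))) w0 w1 := by
  have hcomp : ∀ (m : ℕ) (f : ℂ → ℂ), Continuous f → Continuous fun t => poch (f t) m :=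
    fun m f hf => (continuous_poch m).comp hf
  let f : ℂ → ℂ := fun t => ∑ j ∈ Finset.range (k + 1 + 1),
    vwp (s + t) B C D j * (w0 + w1 * (j * (s + t + j))) * baileyKerRed (a + 2 * t) (s + t) (k + 1) j
  let g : ℂ → ℂ := fun t => poch (1 + (s + t)) (k + 1) * bailRHS (s + t) B C D k *
    bailQuad (s + t) B C D (a + 2 * t) ((k + 1) * (a + 2 * t + (k + 1))) w0 w1
  have hfact : ∀ m : ℕ, (m.factorial : ℂ) ≠ 0 := fun m => by exact_mod_cast m.factorial_ne_zero
  have hf : ContinuousAt f 0 := by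
    refine tendsto_finsetSum _ fun j hj => ?_
    have hj' : j ≤ k + 1 := by simpa [Nat.lt_succ_iff] using hj
    refine ContinuousAt.mul (ContinuousAt.mul ?_ (by fun_prop)) ?_
    · unfold vwp
      refine ContinuousAt.div ?_ ?_ ?_
      · have : ContinuousAt (fun t => (s + t + 2 * j) / (s + t)) 0 :=
          ContinuousAt.div (by fun_prop) (by fun_prop) (by simpa using hs)
        have := (hcomp j (fun t => s + t) (by fun_prop)).continuousAt (x := 0)
        fun_prop
      · have := (hcomp j (fun t => 1 + (s + t) - B) (by fun_prop)).continuousAt (x := 0)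
        have := (hcomp j (fun t => 1 + (s + t) - C) (by fun_prop)).continuousAt (x := 0)
        have := (hcomp j (fun t => 1 + (s + t) - D) (by fun_prop)).continuousAt (x := 0)
        fun_prop
      · simp only [add_zero, mul_ne_zero_iff]
        exact ⟨⟨⟨hfact j, poch_ne_zero_of_le hj' hB⟩, poch_ne_zero_of_le hj' hC⟩,
          poch_ne_zero_of_le hj' hD⟩
    · unfold baileyKerRed
      refine ContinuousAt.div ?_ ?_ ?_
      · have := (hcomp j (fun t => a + 2 * t + (k + 1 : ℕ)) (by fun_prop)).continuousAt (x := 0)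
        have := (hcomp (k + 1 - j) (fun t => a + 2 * t - (s + t)) (by fun_prop)).continuousAt
          (x := 0)
        fun_prop
      · have := (hcomp j (fun t => 1 + (s + t) + (k + 1 : ℕ)) (by fun_prop)).continuousAt (x := 0)
        fun_prop
      · simp only [add_zero, mul_ne_zero_iff]
        exact ⟨hfact _, poch_ne_zero_of_le hj' h1⟩
  have hg : ContinuousAt g 0 := by
    have := (hcomp (k + 1) (fun t => 1 + (s + t)) (by fun_prop)).continuousAt (x := 0)
    refine ContinuousAt.mul (ContinuousAt.mul this ?_) (by unfold bailQuad; fun_prop)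
    unfold bailRHS
    refine ContinuousAt.div ?_ ?_ ?_
    · have := (hcomp k (fun t => 1 + (s + t) - C - D) (by fun_prop)).continuousAt (x := 0)
      have := (hcomp k (fun t => 1 + (s + t) - B - D) (by fun_prop)).continuousAt (x := 0)
      have := (hcomp k (fun t => 1 + (s + t) - B - C) (by fun_prop)).continuousAt (x := 0)
      fun_prop
    · have := (hcomp (k + 1) (fun t => 1 + (s + t) - B) (by fun_prop)).continuousAt (x := 0)
      have := (hcomp (k + 1) (fun t => 1 + (s + t) - C) (by fun_prop)).continuousAt (x := 0)
      have := (hcomp (k + 1) (fun t => 1 + (s + t) - D) (by fun_prop)).continuousAt (x := 0)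
      fun_prop
    · simp only [add_zero, mul_ne_zero_iff]
      exact ⟨⟨⟨hfact _, hB⟩, hC⟩, hD⟩
  have hev : ∀ᶠ t in 𝓝[≠] (0 : ℂ), f t = g t := by
    have hX : ∀ X : ℂ, poch (1 + s - X) (k + 1) ≠ 0 →
        ∀ᶠ t in 𝓝[≠] (0 : ℂ), poch (1 + (s + t) - X) (k + 1) ≠ 0 := fun X hX =>
      (((hcomp (k + 1) (fun t => 1 + (s + t) - X) (by fun_prop)).continuousAt (x := 0)).eventually_ne
        (by simpa using hX)).filter_mono nhdsWithin_le_nhds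
    filter_upwards [hX B hB, hX C hC, hX D hD, eventually_poch_ne_zero a two_ne_zero (k + 1),
      eventually_poch_ne_zero (1 + s) one_ne_zero (2 * (k + 1)),
      eventually_poch_ne_zero s one_ne_zero 1] with t tB tC tD ta t1 ts
    rw [one_mul, add_assoc] at t1
    have ts' : s + t ≠ 0 := by simpa [poch_succ, poch_zero] using ts
    have key := sum_vwp_baileyKer_balance_two w0 w1 k ts'
      (show a + 2 * t = 2 * (s + t) - B - C - D by rw [ha]; ring) t1 tB tC tD
    have t2 := poch_ne_zero_of_le (show k + 1 ≤ 2 * (k + 1) by omega) t1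
    have hc : poch (a + 2 * t) (k + 1) / poch (1 + (s + t)) (k + 1) ≠ 0 := div_ne_zero ta t2
    apply mul_left_cancel₀ hc
    simp only [f, g]
    rw [Finset.mul_sum]
    trans poch (a + 2 * t) (k + 1) * bailRHS (s + t) B C D k *
      bailQuad (s + t) B C D (a + 2 * t) ((k + 1) * (a + 2 * t + (k + 1))) w0 w1
    · rw [← key]
      refine Finset.sum_congr rfl fun j _ => ?_
      rw [baileyKer_eq]
      ring
    · field_simp
  have hlim : f 0 = g 0 := tendsto_nhds_unique
    ((hf.tendsto.mono_left nhdsWithin_le_nhds).congr' hev)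
    (hg.tendsto.mono_left nhdsWithin_le_nhds)
  simpa [f, g] using hlim

lemma vwp_zero {s : ℂ} (B C D : ℂ) (hs : s ≠ 0) : vwp s B C D 0 = 1 := by
  simp [vwp, poch_zero, hs]

lemma sum_vwp_baileyKerRed_mul {s B C D a : ℂ} (w0 w1 : ℂ) (k : ℕ) (hs : s ≠ 0)
    (ha : a = 2 * s - B - C - D) (h1 : poch (1 + s + k) k ≠ 0)
    (hB : poch (1 + s - B) k ≠ 0) (hC : poch (1 + s - C) k ≠ 0) (hD : poch (1 + s - D) k ≠ 0) :
    (s - C - D) * (s - B - D) * (s - B - C) * ∑ j ∈ Finset.range (k + 1),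
        vwp s B C D j * (w0 + w1 * (j * (s + j))) * baileyKerRed a s k j =
      poch (1 + s) k * (poch (s - C - D) k * poch (s - B - D) k * poch (s - B - C) k /
        (k.factorial * poch (1 + s - B) k * poch (1 + s - C) k * poch (1 + s - D) k)) *
        bailQuad s B C D a (k * (a + k)) w0 w1 := by
  cases k with
  | zero =>
    simp [vwp_zero _ _ _ hs, baileyKerRed, bailQuad, poch_zero]
    ring
  | succ k =>
    rw [sum_vwp_baileyKerRed w0 w1 k hs ha h1 hB hC hD, bailRHS]
    have h : ∀ X Y : ℂ, s - X - Y + 1 = 1 + s - X - Y := fun X Y => by ring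
    simp only [poch_succ_left (s - C - D), poch_succ_left (s - B - D), poch_succ_left (s - B - C), h]
    push_cast
    ring

/-- Pairs `(u + 1)ₖ (v + 1)ₖ / ((u)ₖ (v)ₖ)` are quadratic in `k`. -/
lemma poch_succ_pair_div {u v : ℂ} (k : ℕ) (hu : u ≠ 0) (hv : v ≠ 0) (hu' : poch u k ≠ 0)
    (hv' : poch v k ≠ 0) :
    poch (u + 1) k * poch (v + 1) k / (poch u k * poch v k) = 1 + k * (u + v + k) / (u * v) := by
  have h1 : poch (u + 1) k = poch u k * (u + k) / u := by
    rw [← poch_succ, poch_succ_left]; field_simp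
  have h2 : poch (v + 1) k = poch v k * (v + k) / v := by
    rw [← poch_succ, poch_succ_left]; field_simp
  rw [h1, h2]
  field_simp
  ring

lemma poch_one_add_half_div {a : ℂ} (k : ℕ) (ha : a ≠ 0) (h : poch (a / 2) k ≠ 0) :
    poch (1 + a / 2) k / poch (a / 2) k = (a + 2 * k) / a := by
  have h1 : poch (a / 2 + 1) k = poch (a / 2) k * (a / 2 + k) / (a / 2) := by
    rw [← poch_succ, poch_succ_left]; field_simp
  rw [add_comm 1 (a / 2), h1]
  field_simp

/-- Expansion of a very-well-poised term with a quadratic factor over the base `s`. -/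
lemma quad_term_eq_sum {a b c d s P Γ : ℂ} (k : ℕ) (hs : s = 2 * a - b - c - d) (hs0 : s ≠ 0)
    (hP : P ≠ 0) (hΓ : Γ ≠ 0)
    (hΓP : Γ * (b * c * d + P * (a - b - c - d)) = P * ((a - b - c) * (a - b - d) * (a - c - d)))
    (h1 : poch (1 + s) (2 * k) ≠ 0) (hb : poch (1 + a - b) k ≠ 0) (hc : poch (1 + a - c) k ≠ 0)
    (hd : poch (1 + a - d) k ≠ 0) :
    poch a k * poch b k * poch c k * poch d k /
        (k.factorial * poch (1 + a - b) k * poch (1 + a - c) k * poch (1 + a - d) k) *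
        (1 + k * (a + k) / P) =
      ∑ j ∈ Finset.range (k + 1), vwp s (s + b - a) (s + c - a) (s + d - a) j *
        (1 + 1 / Γ * (j * (s + j))) * baileyKer a s k j := by
  cases k with
  | zero => simp [vwp_zero _ _ _ hs0, poch_zero, baileyKer]
  | succ k =>
    have e : ∀ X : ℂ, 1 + s - (s + X - a) = 1 + a - X := fun X => by ring
    rw [sum_vwp_baileyKer_balance_two 1 (1 / Γ) k hs0 (by rw [hs]; ring) h1 (by rwa [e])
      (by rwa [e]) (by rwa [e]), bailRHS, e, e, e]
    have e1 : 1 + a - c - (s + d - a) = b + 1 := by rw [hs]; ring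
    have e2 : 1 + a - b - (s + d - a) = c + 1 := by rw [hs]; ring
    have e3 : 1 + a - b - (s + c - a) = d + 1 := by rw [hs]; ring
    have hq : bailQuad s (s + b - a) (s + c - a) (s + d - a) a ((k + 1) * (a + (k + 1))) 1 (1 / Γ) =
        b * c * d * (1 + (k + 1) * (a + (k + 1)) / P) := by
      unfold bailQuad
      field_simp
      rw [hs]
      linear_combination (-((k : ℂ) + 1) * (a + (k + 1))) * hΓP
    rw [e1, e2, e3, hq, poch_succ_left b, poch_succ_left c, poch_succ_left d]
    push_cast
    ring

/-- The part of the summand of the series over the base `a` involving `e`, `f`, `g` and `-n`. -/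
noncomputable def outerTerm (a e f g : ℂ) (n k : ℕ) : ℂ :=
  (a + 2 * k) / a * (poch e k * poch f k * poch g k * poch (-(n : ℂ)) k /
    (poch (1 + a - e) k * poch (1 + a - f) k * poch (1 + a - g) k * poch (1 + a + n) k))

/-- The part of the summand of the series over the base `s` involving `e`, `f`, `g` and `-n`. -/
noncomputable def innerTerm (s e f g : ℂ) (n j : ℕ) : ℂ :=
  poch e j * poch f j * poch g j * poch (-(n : ℂ)) j /
    (poch (1 + s - e) j * poch (1 + s - f) j * poch (1 + s - g) j * poch (1 + s + n) j)

/-- The `m`-independent factor of `outerTerm a e f g (j + N) (j + m) * baileyKer a s (j + m) j`. -/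
noncomputable def outerConst (a s e f g : ℂ) (j N : ℕ) : ℂ :=
  (-1) ^ (j + N) * (j + N).factorial * ((a + 2 * j) / a) * poch a (2 * j) *
    (poch e j * poch f j * poch g j) /
    (poch (1 + a - e) j * poch (1 + a - f) j * poch (1 + a - g) j *
      poch (1 + a + (j + N : ℕ)) j * poch (1 + s) (2 * j + N))

lemma outerTerm_mul_baileyKer {a s e f g : ℂ} {j N m : ℕ} (hm : m ≤ N) (ha : a + 2 * j ≠ 0)
    (h1 : poch (1 + s) (2 * j + N) ≠ 0) :
    outerTerm a e f g (j + N) (j + m) * baileyKer a s (j + m) j =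
      outerConst a s e f g j N * (vwp (a + 2 * j) (e + j) (f + j) (g + j) m *
        baileyKerRed (a - s - N) (a + 2 * j) N m) := by
  obtain ⟨r, rfl⟩ : ∃ r, N = m + r := ⟨N - m, by omega⟩
  have d1 : j + m - j = m := by omega
  have d2 : m + r - m = r := by omega
  have d3 : j + m + j = 2 * j + m := by omega
  have d4 : j + (m + r) - (j + m) = r := by omega
  have d5 : 2 * j + (m + r) = 2 * j + m + r := by omega
  have e1 : ∀ X : ℂ, 1 + (a + 2 * j) - (X + j) = 1 + a - X + j := fun X => by ring
  have e2 : a - s - ((m + r : ℕ) : ℂ) + ((m + r : ℕ) : ℂ) = a - s := by ring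
  have e3 : 1 + (a + 2 * j) + ((m + r : ℕ) : ℂ) = 1 + a + ((j + (m + r) : ℕ) : ℂ) + j := by
    push_cast; ring
  have e4 : a - s - ((m + r : ℕ) : ℂ) - (a + 2 * j) = 1 - (1 + s + ((2 * j + m : ℕ) : ℂ)) - r := by
    push_cast; ring
  rw [d5, poch_add, mul_ne_zero_iff] at h1
  obtain ⟨h1, h2⟩ := h1
  rw [outerTerm, baileyKer, outerConst, vwp, baileyKerRed, poch_neg_natCast (by omega), d1, d2, d3,
    d4, d5, poch_add (1 + s) (2 * j + m) r, e1, e1, e1, e2, e3, e4, poch_reflect]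
  simp only [poch_add _ j m, poch_add a (2 * j) m]
  push_cast at h2 ⊢
  generalize poch (1 + s) (2 * j + m) = X1 at *
  generalize poch (1 + s + (2 * (j : ℂ) + m)) r = X2 at *
  have hsgn : ((-1 : ℂ)) ^ (j + (m + r)) * (-1) ^ r = (-1) ^ (j + m) := by
    rw [← add_assoc, pow_add _ (j + m) r, mul_assoc, ← mul_pow]; simp
  rw [← hsgn]
  generalize ((-1 : ℂ)) ^ (j + (m + r)) = σ
  have hx : a + 2 * ((j : ℂ) + m) = a + 2 * j + 2 * m := by ring
  rw [hx]
  generalize hy : a + 2 * (j : ℂ) + 2 * m = y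
  generalize hz : a + 2 * (j : ℂ) = z at *
  have h3 : X2 / X2 = 1 := div_self h2
  have h4 : z / z = 1 := div_self ha
  trans σ * (-1) ^ r * ((j + (m + r)).factorial / r.factorial) * (y / a) *
      (poch a (2 * j) * poch z m * poch (a - s) m / (m.factorial * X1)) *
      (poch e j * poch (e + j) m * (poch f j * poch (f + j) m) * (poch g j * poch (g + j) m) /
      (poch (1 + a - e) j * poch (1 + a - e + j) m * (poch (1 + a - f) j * poch (1 + a - f + j) m) *
        (poch (1 + a - g) j * poch (1 + a - g + j) m) *
        (poch (1 + a + (j + (m + r))) j * poch (1 + a + (j + (m + r)) + j) m))) * (X2 / X2) * (z / z)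
  · rw [h3, h4]; ring
  · ring

/-- The factor in front of the series over the base `s`, without its quadratic part. -/
noncomputable def shiftFactor (a s e f g : ℂ) (n : ℕ) : ℂ :=
  poch (1 + a) n * poch (1 + s - e) n * poch (1 + s - f) n * poch (1 + s - g) n /
    (poch (1 + s) n * poch (1 + a - e) n * poch (1 + a - f) n * poch (1 + a - g) n)

lemma outerConst_mul {a s e f g : ℂ} {j N : ℕ} (hbal : s + a + (j + N : ℕ) = e + f + g)
    (ha0 : a ≠ 0) (h1a : poch (1 + a + (j + N : ℕ)) j ≠ 0)
    (he : poch (1 + s - e) j ≠ 0) (hf : poch (1 + s - f) j ≠ 0) (hg : poch (1 + s - g) j ≠ 0) :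
    outerConst a s e f g j N * (poch (1 + (a + 2 * j)) N *
      (poch (a - f - g) N * poch (a - e - g) N * poch (a - e - f) N /
        (N.factorial * poch (1 + a - e + j) N * poch (1 + a - f + j) N * poch (1 + a - g + j) N))) =
      shiftFactor a s e f g (j + N) * innerTerm s e f g (j + N) j := by
  have e1 : a - f - g = 1 - (1 + s - e + j) - N := by push_cast at hbal; linear_combination hbal
  have e2 : a - e - g = 1 - (1 + s - f + j) - N := by push_cast at hbal; linear_combination hbal
  have e3 : a - e - f = 1 - (1 + s - g + j) - N := by push_cast at hbal; linear_combination hbal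
  have d1 : 2 * j + N = j + N + j := by omega
  have d2 : j + N - j = N := by omega
  have hp : (a + 2 * j) * (poch a (2 * j) * poch (1 + (a + 2 * j)) N) =
      a * (poch (1 + a) (j + N) * poch (1 + a + (j + N : ℕ)) j) := by
    have t1 : poch a (2 * j + N + 1) =
        poch a (2 * j) * ((a + 2 * j) * poch (1 + (a + 2 * j)) N) := by
      rw [add_assoc, poch_add, poch_succ_left, add_comm _ (1 : ℂ)]
      push_cast
      rfl
    have t2 : poch a (2 * j + N + 1) =
        a * (poch (1 + a) (j + N) * poch (1 + a + (j + N : ℕ)) j) := by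
      rw [poch_succ_left, d1, poch_add, add_comm a 1]
    rw [← t2, t1]; ring
  rw [outerConst, shiftFactor, innerTerm, e1, e2, e3, poch_reflect, poch_reflect, poch_reflect,
    poch_neg_natCast (by omega), d1, d2, poch_add (1 + s) (j + N) j, poch_add (1 + s - e) j N,
    poch_add (1 + s - f) j N, poch_add (1 + s - g) j N, poch_add (1 + a - e) j N,
    poch_add (1 + a - f) j N, poch_add (1 + a - g) j N]
  have hsgn : ((-1 : ℂ)) ^ N * (-1) ^ N = 1 := by rw [← mul_pow]; simp
  rw [pow_add]
  generalize ((-1 : ℂ)) ^ N = σ at *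
  generalize ((-1 : ℂ)) ^ j = τ
  generalize poch (1 + a + (j + N : ℕ)) j = Y at *
  generalize poch (1 + (a + 2 * (j : ℂ))) N = Z at *
  generalize hz : a + 2 * (j : ℂ) = z at *
  generalize poch a (2 * j) = W at *
  generalize poch (1 + a) (j + N) = V at *
  have hq : z / a * W * Z / Y = V := by
    field_simp
    linear_combination hp
  rw [← hq]
  generalize poch (1 + s - e) j = A1 at *
  generalize poch (1 + s - f) j = A2 at *
  generalize poch (1 + s - g) j = A3 at *
  have h1 := div_self he
  have h2 := div_self hf
  have h3 := div_self hg
  generalize (1 : ℂ) + s = r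
  generalize (1 : ℂ) + a = r'
  trans (σ * σ) * (σ * σ) * ((A1 / A1) * (A2 / A2) * (A3 / A3)) * (z / a * W * Z / Y * τ *
    ((j + N).factorial / N.factorial) * (poch e j * poch f j * poch g j) *
    (poch (r - e + j) N * poch (r - f + j) N * poch (r - g + j) N) /
    (poch (r' - e) j * poch (r' - f) j * poch (r' - g) j * (poch r (j + N) * poch (r + ↑(j + N)) j) *
     (poch (r' - e + j) N * poch (r' - f + j) N * poch (r' - g + j) N)))
  · rw [h1, h2, h3]; ring
  · rw [hsgn]; ring

/-- The inner sum of the interchanged double series. -/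
lemma inner_sum_eq {a s e f g Q : ℂ} {j N : ℕ} (hbal : s + a + (j + N : ℕ) = e + f + g)
    (ha : a + 2 * j ≠ 0) (ha0 : a ≠ 0) (h1a : poch (1 + a + (j + N : ℕ)) (j + N) ≠ 0)
    (h1s : poch (1 + s) (2 * (j + N)) ≠ 0)
    (he : poch (1 + s - e) (j + N) ≠ 0) (hf : poch (1 + s - f) (j + N) ≠ 0)
    (hg : poch (1 + s - g) (j + N) ≠ 0) (he' : poch (1 + a - e) (j + N) ≠ 0)
    (hf' : poch (1 + a - f) (j + N) ≠ 0) (hg' : poch (1 + a - g) (j + N) ≠ 0) :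
    (a - f - g) * (a - e - g) * (a - e - f) * ∑ m ∈ Finset.range (N + 1),
        outerTerm a e f g (j + N) (j + m) * (Q + (j + m : ℕ) * (a + (j + m : ℕ))) *
          baileyKer a s (j + m) j =
      shiftFactor a s e f g (j + N) * innerTerm s e f g (j + N) j *
        bailQuad (a + 2 * j) (e + j) (f + j) (g + j) (a - s - N) (N * (a - s))
          (Q + j * (a + j)) 1 := by
  have h1s' := poch_ne_zero_of_le (show 2 * j + N ≤ 2 * (j + N) by omega) h1s
  have hX : ∀ X : ℂ, 1 + (a + 2 * j) - (X + j) = 1 + a - X + j := fun X => by ring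
  have hX' : ∀ X Y : ℂ, a + 2 * j - (X + j) - (Y + j) = a - X - Y := fun X Y => by ring
  have hY : ∀ X : ℂ, poch (1 + a - X) (j + N) ≠ 0 →
      poch (1 + (a + 2 * j) - (X + j)) N ≠ 0 := by
    intro X h
    rw [poch_add, mul_ne_zero_iff] at h
    rw [hX]; exact h.2
  have hN : poch (1 + (a + 2 * j) + N) N ≠ 0 := by
    rw [poch_add, mul_ne_zero_iff] at h1a
    convert h1a.2 using 2
    push_cast
    ring
  have key := sum_vwp_baileyKerRed_mul (a := a - s - N) (Q + j * (a + j)) 1 N ha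
    (by push_cast at hbal; linear_combination -hbal) hN (hY e he') (hY f hf') (hY g hg')
  simp only [hX, hX'] at key
  have hsum : ∑ m ∈ Finset.range (N + 1),
        outerTerm a e f g (j + N) (j + m) * (Q + (j + m : ℕ) * (a + (j + m : ℕ))) *
          baileyKer a s (j + m) j =
      outerConst a s e f g j N * ∑ m ∈ Finset.range (N + 1),
        vwp (a + 2 * j) (e + j) (f + j) (g + j) m *
          (Q + j * (a + j) + 1 * (m * (a + 2 * j + m))) *
          baileyKerRed (a - s - N) (a + 2 * j) N m := by
    rw [Finset.mul_sum]
    refine Finset.sum_congr rfl fun m hm => ?_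
    have hm' : m ≤ N := by simpa [Nat.lt_succ_iff] using hm
    have := outerTerm_mul_baileyKer (e := e) (f := f) (g := g) hm' ha h1s'
    push_cast
    linear_combination (Q + (j + m) * (a + (j + m))) * this
  have hxa : a - s - N + N = a - s := by ring
  rw [hxa] at key
  rw [← outerConst_mul hbal ha0 (poch_ne_zero_of_le (by omega) h1a)
    (poch_ne_zero_of_le (by omega) he) (poch_ne_zero_of_le (by omega) hf)
    (poch_ne_zero_of_le (by omega) hg), hsum]
  linear_combination (outerConst a s e f g j N) * key

lemma sum_range_triangle (n : ℕ) (F : ℕ → ℕ → ℂ) :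
    ∑ k ∈ Finset.range (n + 1), ∑ j ∈ Finset.range (k + 1), F k j =
      ∑ j ∈ Finset.range (n + 1), ∑ m ∈ Finset.range (n - j + 1), F (j + m) j := by
  rw [Finset.sum_comm' (t' := Finset.range (n + 1)) (s' := fun j => Finset.Ico j (n + 1))
    (fun x y => by simp only [Finset.mem_range, Finset.mem_Ico]; omega)]
  refine Finset.sum_congr rfl fun j hj => ?_
  rw [Finset.sum_Ico_eq_sum_range, show n + 1 - j = n - j + 1 by
    have := Finset.mem_range.1 hj; omega]

/-- A very-well-poised series with two unit-shifted pairs has a quadratic factor for each pair. -/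
lemma hypTerm_quadratic {A u v w z : ℂ} (b c d e f g b' c' d' e' f' g' h' : ℂ) (n : ℕ)
    (hA : A ≠ 0) (hu : u ≠ 0) (hv : v ≠ 0) (hw : w ≠ 0) (hz : z ≠ 0)
    (hA' : poch (A / 2) n ≠ 0) (hu' : poch u n ≠ 0) (hv' : poch v n ≠ 0) (hw' : poch w n ≠ 0)
    (hz' : poch z n ≠ 0) :
    hypTerm [A, 1 + A / 2, b, c, d, e, f, g, u + 1, v + 1, w + 1, z + 1]
        [A / 2, b', c', d', e', f', g', v, u, z, w, h'] n 1 =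
      ∑ k ∈ Finset.range (n + 1),
        poch A k * poch b k * poch c k * poch d k /
            (k.factorial * poch b' k * poch c' k * poch d' k) * ((A + 2 * k) / A) *
          (poch e k * poch f k * poch g k * poch (-(n : ℂ)) k /
            (poch e' k * poch f' k * poch g' k * poch h' k)) *
          (1 + k * (u + v + k) / (u * v)) * (1 + k * (w + z + k) / (w * z)) := by
  refine Finset.sum_congr rfl fun k hk => ?_
  have hk' : k ≤ n := by simpa [Nat.lt_succ_iff] using hk
  rw [← poch_one_add_half_div k hA (poch_ne_zero_of_le hk' hA'),
    ← poch_succ_pair_div k hu hv (poch_ne_zero_of_le hk' hu') (poch_ne_zero_of_le hk' hv'),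
    ← poch_succ_pair_div k hw hz (poch_ne_zero_of_le hk' hw') (poch_ne_zero_of_le hk' hz')]
  simp only [List.map_cons, List.map_nil, List.prod_cons, List.prod_nil, one_pow]
  ring

lemma hypTerm_zero (A B : List ℂ) (x : ℂ) : hypTerm A B 0 x = 1 := by
  simp [hypTerm, poch_zero]

lemma bailQuad_shift {a s e f g : ℂ} {j N : ℕ} (Q : ℂ)
    (hbal : s + a + (j + N : ℕ) = e + f + g) :
    bailQuad (a + 2 * j) (e + j) (f + j) (g + j) (a - s - N) (N * (a - s)) (Q + j * (a + j)) 1 =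
      Q * ((a - e - f) * (a - e - g) * (a - f - g)) +
        (j + N : ℕ) * (a - s) * (e * f * g + Q * (a - e - f - g)) +
      ((a - e - f) * (a - e - g) * (a - f - g) -
        (a - s) * (e * f + e * g + f * g + a * (a - e - f - g) - Q)) * (j * (s + j)) := by
  obtain rfl : s = e + f + g - a - (j + N : ℕ) := by linear_combination hbal
  unfold bailQuad
  push_cast
  ring

lemma add_add_mul_eq_mul {A D E F Q Δ x y : ℂ} (hΔ0 : Δ ≠ 0) (hE0 : E ≠ 0)
    (hΔ : Δ * D = Q * A) (hE : E * F = Q * A + x * D) :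
    Q * A + x * D + F * y = A * (Q * ((1 + x / Δ) * (1 + y / E))) := by
  field_simp
  linear_combination y * Δ * hE + (E + y) * x * hΔ

theorem proposition_13P3 (n : ℕ) (a b c d e f g p q : ℂ)
    (hsaal : 3 * a = b + c + d + e + f + g - (n : ℂ))
    (lm mu : ℂ) (hlm : lm = 2 * a - b - c - d) (hmu : mu = 2 * a - e - f - g)
    (hγd : b * c * d + p * (a - p) * (a - b - c - d) ≠ 0)
    (hδd : e * f * g + q * (a - q) * (a - e - f - g) ≠ 0)
    (hεd : (a - e - f) * (a - e - g) * (a - f - g) -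
        (mu + (n : ℂ)) * (e * f + e * g + f * g + a * (a - e - f - g) - q * (a - q)) ≠ 0)
    (γ δ ε : ℂ)
    (hγ : γ ^ 2 = lm ^ 2 / 4 -
      p * (a - p) * (a - b - c) * (a - b - d) * (a - c - d) /
        (b * c * d + p * (a - p) * (a - b - c - d)))
    (hδ : δ ^ 2 = mu ^ 2 / 4 -
      q * (a - q) * (a - e - f) * (a - e - g) * (a - f - g) /
        (e * f * g + q * (a - q) * (a - e - f - g)))
    (hε : ε ^ 2 = lm ^ 2 / 4 -
      (q * (a - q) * (a - e - f) * (a - e - g) * (a - f - g) +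
          (n : ℂ) * (mu + (n : ℂ)) * (e * f * g + q * (a - q) * (a - e - f - g))) /
        ((a - e - f) * (a - e - g) * (a - f - g) -
          (mu + (n : ℂ)) * (e * f + e * g + f * g + a * (a - e - f - g) - q * (a - q))))
    (hnd : ∀ z ∈ [a / 2, 1 + a - b, 1 + a - c, 1 + a - d, 1 + a - e, 1 + a - f, 1 + a - g,
        p, a - p, q, a - q, 1 + a + (n : ℂ),
        lm / 2, 1 + lm - e, 1 + lm - f, 1 + lm - g,
        lm / 2 + γ, lm / 2 - γ, lm / 2 + ε, lm / 2 - ε, 1 + lm + (n : ℂ), 1 + lm,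
        mu / 2 + δ, mu / 2 - δ],
      ∀ k ≤ n, poch z k ≠ 0) :
    hypTerm [a, 1 + a / 2, b, c, d, e, f, g, a - p + 1, p + 1, a - q + 1, q + 1]
        [a / 2, 1 + a - b, 1 + a - c, 1 + a - d, 1 + a - e, 1 + a - f, 1 + a - g,
          p, a - p, q, a - q, 1 + a + (n : ℂ)] n 1
      = poch (1 + a) n * poch (1 + lm - e) n * poch (1 + lm - f) n * poch (1 + lm - g) n /
          (poch (1 + lm) n * poch (1 + a - e) n * poch (1 + a - f) n * poch (1 + a - g) n) *
        (poch (mu / 2 - δ + 1) n * poch (mu / 2 + δ + 1) n /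
          (poch (mu / 2 + δ) n * poch (mu / 2 - δ) n)) *
        hypTerm [lm, 1 + lm / 2, lm + b - a, lm + c - a, lm + d - a, e, f, g,
            lm / 2 - γ + 1, lm / 2 + γ + 1, lm / 2 - ε + 1, lm / 2 + ε + 1]
          [lm / 2, 1 + a - b, 1 + a - c, 1 + a - d, 1 + lm - e, 1 + lm - f, 1 + lm - g,
            lm / 2 + γ, lm / 2 - γ, lm / 2 + ε, lm / 2 - ε, 1 + lm + (n : ℂ)] n 1 := by
  have hbal : lm + a + (n : ℂ) = e + f + g := by linear_combination hlm + hsaal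
  obtain rfl : mu = a - lm - n := by linear_combination hmu + hbal
  simp only [List.forall_mem_cons] at hnd
  obtain ⟨ha2, hb, hc, hd, he, hf, hg, hp, hp', hq, hq', hN, hl2, hle, hlf, hlg, hγ1, hγ2, hε1, hε2,
    hlN, hl, hδ1, hδ2, -⟩ := hnd
  rcases Nat.eq_zero_or_pos n with rfl | hn
  · simp [hypTerm_zero, poch_zero]
  have hne : ∀ {z : ℂ}, (∀ k ≤ n, poch z k ≠ 0) → z ≠ 0 := fun h => by
    simpa using poch_ne_zero_iff.1 (h n le_rfl) 0 hn
  have ha0 : a ≠ 0 := fun h => hne ha2 (by rw [h]; simp)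
  have hl0 : lm ≠ 0 := fun h => hne hl2 (by rw [h]; simp)
  rw [hypTerm_quadratic b c d e f g _ _ _ _ _ _ _ n ha0 (hne hp') (hne hp) (hne hq') (hne hq)
      (ha2 n le_rfl) (hp' n le_rfl) (hp n le_rfl) (hq' n le_rfl) (hq n le_rfl),
    hypTerm_quadratic _ _ _ e f g _ _ _ _ _ _ _ n hl0 (hne hγ2) (hne hγ1) (hne hε2) (hne hε1)
      (hl2 n le_rfl) (hγ2 n le_rfl) (hγ1 n le_rfl) (hε2 n le_rfl) (hε1 n le_rfl),
    mul_comm (poch ((a - lm - n) / 2 + δ) n),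
    poch_succ_pair_div n (hne hδ2) (hne hδ1) (hδ2 n le_rfl) (hδ1 n le_rfl)]
  have hQ : (a - q) * q ≠ 0 := mul_ne_zero (hne hq') (hne hq)
  have hP : (a - p) * p ≠ 0 := mul_ne_zero (hne hp') (hne hp)
  have hΓ : (lm / 2 - γ) * (lm / 2 + γ) ≠ 0 := mul_ne_zero (hne hγ2) (hne hγ1)
  have hE : (lm / 2 - ε) * (lm / 2 + ε) ≠ 0 := mul_ne_zero (hne hε2) (hne hε1)
  have hΔ : ((a - lm - n) / 2 - δ) * ((a - lm - n) / 2 + δ) ≠ 0 := mul_ne_zero (hne hδ2) (hne hδ1)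
  have hΓP : (lm / 2 - γ) * (lm / 2 + γ) * (b * c * d + (a - p) * p * (a - b - c - d)) =
      (a - p) * p * ((a - b - c) * (a - b - d) * (a - c - d)) := by
    have := congrArg (· * (b * c * d + p * (a - p) * (a - b - c - d))) hγ
    simp only [sub_mul, div_mul_cancel₀ _ hγd] at this
    linear_combination -this
  have hΔQ : ((a - lm - n) / 2 - δ) * ((a - lm - n) / 2 + δ) *
      (e * f * g + (a - q) * q * (a - e - f - g)) =
      (a - q) * q * ((a - e - f) * (a - e - g) * (a - f - g)) := by
    have := congrArg (· * (e * f * g + q * (a - q) * (a - e - f - g))) hδ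
    simp only [sub_mul, div_mul_cancel₀ _ hδd] at this
    linear_combination -this
  have hEZ : (lm / 2 - ε) * (lm / 2 + ε) * ((a - e - f) * (a - e - g) * (a - f - g) -
        (a - lm) * (e * f + e * g + f * g + a * (a - e - f - g) - (a - q) * q)) =
      (a - q) * q * ((a - e - f) * (a - e - g) * (a - f - g)) +
        n * (a - lm) * (e * f * g + (a - q) * q * (a - e - f - g)) := by
    have h := eq_sub_iff_add_eq.1 hε
    rw [← eq_sub_iff_add_eq', div_eq_iff hεd] at h
    linear_combination -h
  have hx : ∀ {X : ℂ}, (∀ k ≤ n, poch (1 + lm - X) k ≠ 0) → 1 + lm - X + (n - 1 : ℕ) ≠ 0 :=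
    fun h => poch_ne_zero_iff.1 (h n le_rfl) (n - 1) (by omega)
  have hA2 : (a - f - g) * (a - e - g) * (a - e - f) ≠ 0 := by
    have h1 := hx hle
    have h2 := hx hlf
    have h3 := hx hlg
    rw [Nat.cast_pred hn] at h1 h2 h3
    refine mul_ne_zero (mul_ne_zero ?_ ?_) ?_
    · exact fun h => h1 (by linear_combination hbal - h)
    · exact fun h => h2 (by linear_combination hbal - h)
    · exact fun h => h3 (by linear_combination hbal - h)
  have hl2n : poch (1 + lm) (2 * n) ≠ 0 := by
    rw [two_mul, poch_add]
    exact mul_ne_zero (hl n le_rfl) (hlN n le_rfl)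
  have ha2j : ∀ j ≤ n, a + 2 * (j : ℂ) ≠ 0 := by
    intro j hj h0
    rcases hj.lt_or_eq with hj | rfl
    · exact poch_ne_zero_iff.1 (ha2 n le_rfl) j hj (by linear_combination h0 / 2)
    · refine poch_ne_zero_iff.1 (hN j le_rfl) (j - 1) (by omega) ?_
      rw [Nat.cast_pred hn]
      linear_combination h0
  have hleft : ∀ k ∈ Finset.range (n + 1),
      poch a k * poch b k * poch c k * poch d k /
          (k.factorial * poch (1 + a - b) k * poch (1 + a - c) k * poch (1 + a - d) k) *
          ((a + 2 * k) / a) *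
        (poch e k * poch f k * poch g k * poch (-(n : ℂ)) k /
          (poch (1 + a - e) k * poch (1 + a - f) k * poch (1 + a - g) k * poch (1 + a + n) k)) *
        (1 + k * (a - p + p + k) / ((a - p) * p)) * (1 + k * (a - q + q + k) / ((a - q) * q)) =
      ∑ j ∈ Finset.range (k + 1), vwp lm (lm + b - a) (lm + c - a) (lm + d - a) j *
        (1 + 1 / ((lm / 2 - γ) * (lm / 2 + γ)) * (j * (lm + j))) * (1 / ((a - q) * q)) *
        (outerTerm a e f g n k * ((a - q) * q + k * (a + k)) * baileyKer a lm k j) := by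
    intro k hk
    have hk' : k ≤ n := by simpa [Nat.lt_succ_iff] using hk
    have h := quad_term_eq_sum k hlm hl0 hP hΓ hΓP (poch_ne_zero_of_le (by omega) hl2n)
      (hb k hk') (hc k hk') (hd k hk')
    have hq1 : 1 + k * (a - q + q + k) / ((a - q) * q) =
        1 / ((a - q) * q) * ((a - q) * q + k * (a + k)) := by
      rw [sub_add_cancel]; linear_combination -one_div_mul_cancel hQ
    trans (poch a k * poch b k * poch c k * poch d k /
          (k.factorial * poch (1 + a - b) k * poch (1 + a - c) k * poch (1 + a - d) k) *
          (1 + k * (a + k) / ((a - p) * p))) * (outerTerm a e f g n k *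
            (1 / ((a - q) * q) * ((a - q) * q + k * (a + k))))
    · rw [hq1, sub_add_cancel, outerTerm]; ring
    · rw [h, Finset.sum_mul]
      exact Finset.sum_congr rfl fun j _ => by ring
  rw [Finset.sum_congr rfl hleft, sum_range_triangle, Finset.mul_sum]
  refine Finset.sum_congr rfl fun j hj => ?_
  obtain ⟨N, rfl⟩ : ∃ N, n = j + N :=
    ⟨n - j, by have := Finset.mem_range.1 hj; omega⟩
  have hinner := inner_sum_eq (Q := (a - q) * q) hbal (ha2j j (by omega)) ha0 (hN _ le_rfl) hl2n
    (hle _ le_rfl) (hlf _ le_rfl) (hlg _ le_rfl) (he _ le_rfl) (hf _ le_rfl) (hg _ le_rfl)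
  have hA2' : (a - f - g) * (a - e - g) * (a - e - f) =
      (a - e - f) * (a - e - g) * (a - f - g) := by ring
  rw [hA2'] at hinner hA2
  rw [bailQuad_shift _ hbal, add_add_mul_eq_mul hΔ hE hΔQ hEZ, mul_left_comm] at hinner
  have hsum := mul_left_cancel₀ hA2 hinner
  rw [← Finset.mul_sum, Nat.add_sub_cancel_left]
  have hb' : 1 + lm - (lm + b - a) = 1 + a - b := by ring
  have hc' : 1 + lm - (lm + c - a) = 1 + a - c := by ring
  have hd' : 1 + lm - (lm + d - a) = 1 + a - d := by ring
  have hγ' : lm / 2 - γ + (lm / 2 + γ) + j = lm + j := by ring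
  have hε' : lm / 2 - ε + (lm / 2 + ε) + j = lm + j := by ring
  have hδ' : (a - lm - (j + N : ℕ)) / 2 - δ + ((a - lm - (j + N : ℕ)) / 2 + δ) + (j + N : ℕ) =
      a - lm := by ring
  have hcancel : ∀ v x y : ℂ, v * (1 / ((a - q) * q)) * (x * ((a - q) * q * y)) = v * x * y :=
    fun v x y => by linear_combination v * x * y * one_div_mul_cancel hQ
  rw [hsum, hcancel, vwp, hb', hc', hd', hγ', hε', hδ', shiftFactor, innerTerm]
  ring
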